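/- Define γ : ℤ × ℕ → ℤ by γ(n,0) = n and γ(n,m+1) = Σ_{l=0}^{m} γ(n,m−l)·(γ(n−1,l) + γ(n,l) + γ(n+1,l)). Then for every m ≥ 0 there is a polynomial p_m with integer coefficients such that γ(n,m) = p_m(n) for all n ∈ ℤ, p_m has degree m+1, the leading coefficient of p_m equals 3^m·C_m where C_m is the m-th Catalan number, and p_m has definite parity: γ(−n,m) = (−1)^{m+1}·γ(n,m) for all n ∈ ℤ. -/

import Mathlib

open Polynomial Finset

/-- A symmetric three-term sum of shifts of `p` scales the coefficient of `X ^ d` by `3`. -/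
lemma shift_sum_natDegree_le_and_coeff {p : ℤ[X]} {d : ℕ} (hp : p.natDegree ≤ d) :
    (taylor (-1) p + p + taylor 1 p).natDegree ≤ d ∧
      (taylor (-1) p + p + taylor 1 p).coeff d = 3 * p.coeff d := by
  have hc (r : ℤ) : (taylor r p).coeff d = p.coeff d := by
    rcases hp.lt_or_eq with h | rfl
    · rw [coeff_eq_zero_of_natDegree_lt h,
        coeff_eq_zero_of_natDegree_lt (by rwa [natDegree_taylor])]
    · rw [coeff_taylor_natDegree, leadingCoeff]
  refine ⟨natDegree_add_le_of_degree_le (natDegree_add_le_of_degree_le ?_ hp) ?_, ?_⟩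
  · rwa [natDegree_taylor]
  · rwa [natDegree_taylor]
  · simp only [coeff_add, hc]
    ring

lemma quartic_taylor_coefficients_parity {γ : ℤ → ℕ → ℤ} (h0 : ∀ n : ℤ, γ n 0 = n)
    (hrec : ∀ (n : ℤ) (m : ℕ), γ n (m + 1) =
      ∑ l ∈ range (m + 1), γ n (m - l) * (γ (n - 1) l + γ n l + γ (n + 1) l))
    (m : ℕ) (n : ℤ) : γ (-n) m = (-1) ^ (m + 1) * γ n m := by
  induction m using Nat.strong_induction_on generalizing n with
  | _ m ih =>
    cases m with
    | zero => simp [h0]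
    | succ m =>
      rw [hrec, hrec, mul_sum]
      refine sum_congr rfl fun l hl ↦ ?_
      have hl : l ≤ m := Nat.lt_succ_iff.mp (mem_range.mp hl)
      rw [show -n - 1 = -(n + 1) by ring, show -n + 1 = -(n - 1) by ring,
        ih (m - l) (by omega), ih l (by omega), ih l (by omega), ih l (by omega),
        show m + 1 + 1 = (m - l + 1) + (l + 1) by omega, pow_add]
      ring

lemma quartic_taylor_coefficients_exists_polynomial {γ : ℤ → ℕ → ℤ} (h0 : ∀ n : ℤ, γ n 0 = n)
    (hrec : ∀ (n : ℤ) (m : ℕ), γ n (m + 1) =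
      ∑ l ∈ range (m + 1), γ n (m - l) * (γ (n - 1) l + γ n l + γ (n + 1) l))
    (m : ℕ) : ∃ p : ℤ[X], (∀ n : ℤ, γ n m = p.eval n) ∧ p.natDegree ≤ m + 1 ∧
      p.coeff (m + 1) = 3 ^ m * (catalan m : ℤ) := by
  induction m using Nat.strong_induction_on with
  | _ m ih =>
    cases m with
    | zero => exact ⟨X, by simp [h0], by simp, by simp⟩
    | succ m =>
      choose! P hev hdeg hcoeff using ih
      refine ⟨∑ l ∈ range (m + 1), P (m - l) * (taylor (-1) (P l) + P l + taylor 1 (P l)),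
        fun n ↦ ?_, natDegree_sum_le_of_forall_le _ _ fun l hl ↦ ?_, ?_⟩
      · rw [hrec, eval_finsetSum]
        refine sum_congr rfl fun l hl ↦ ?_
        have hl : l < m + 1 := mem_range.mp hl
        simp only [eval_mul, eval_add, taylor_eval, hev (m - l) (by omega), hev l hl]
        ring_nf
      · have hl : l < m + 1 := mem_range.mp hl
        refine (natDegree_mul_le_of_le (hdeg (m - l) (by omega))
          (shift_sum_natDegree_le_and_coeff (hdeg l hl)).1).trans ?_
        omega
      · rw [finsetSum_coeff, catalan_succ', Nat.sum_antidiagonal_eq_sum_range_succ_mk,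
          Nat.cast_sum, mul_sum]
        refine sum_congr rfl fun l hl ↦ ?_
        have hl : l < m + 1 := mem_range.mp hl
        obtain ⟨hd, hc⟩ := shift_sum_natDegree_le_and_coeff (hdeg l hl)
        rw [show m + 1 + 1 = (m - l + 1) + (l + 1) by omega,
          coeff_mul_add_eq_of_natDegree_le (hdeg (m - l) (by omega)) hd, hc,
          hcoeff (m - l) (by omega), hcoeff l hl,
          show m + 1 = (m - l) + l + 1 by omega, pow_succ, pow_add]
        push_cast
        ring

lemma catalan_ne_zero (n : ℕ) : catalan n ≠ 0 := fun h ↦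
  n.centralBinom_ne_zero (by rw [← succ_mul_catalan_eq_centralBinom, h, mul_zero])

/-- The Taylor coefficients `γ(n,m)` of the recursive coefficients of the quartic matrix
model are polynomials in `n` of degree `m+1`, with leading coefficient `3^m·Cₘ`
(Catalan number) and definite parity `γ(-n,m) = (-1)^{m+1}·γ(n,m)`. -/
theorem quartic_taylor_coefficients_polynomial (γ : ℤ → ℕ → ℤ)
    (h0 : ∀ n : ℤ, γ n 0 = n)
    (hrec : ∀ (n : ℤ) (m : ℕ), γ n (m + 1) =
        ∑ l ∈ Finset.range (m + 1),
          γ n (m - l) * (γ (n - 1) l + γ n l + γ (n + 1) l)) :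
    ∀ m : ℕ, ∃ p : Polynomial ℤ,
      (∀ n : ℤ, γ n m = p.eval n) ∧
      p.natDegree = m + 1 ∧
      p.leadingCoeff = 3 ^ m * (catalan m : ℤ) ∧
      (∀ n : ℤ, γ (-n) m = (-1) ^ (m + 1) * γ n m) := by
  intro m
  obtain ⟨p, hev, hdeg, hcoeff⟩ := quartic_taylor_coefficients_exists_polynomial h0 hrec m
  have hne : p.coeff (m + 1) ≠ 0 := by
    rw [hcoeff]
    exact mul_ne_zero (by positivity) (Nat.cast_ne_zero.mpr (catalan_ne_zero m))
  have hnat : p.natDegree = m + 1 := natDegree_eq_of_le_of_coeff_ne_zero hdeg hne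
  exact ⟨p, hev, hnat, by rw [leadingCoeff, hnat, hcoeff],
    quartic_taylor_coefficients_parity h0 hrec m⟩
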